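/- arXiv:1301.4561 — 4 statements merged into one kernel-verified Lean document; each statement's English description precedes it below -/
import Mathlib

section
/- For every integer n ≥ 1, one has Σ_{i=0}^{n} binom(n,i) · ((2^{i+2}−2)/(i+1)) · B_{i+1} = −((2^{n+2}−2)/(n+1)) · B_{n+1}, where B_k are the Bernoulli numbers. -/
open scoped BigOperators

open PowerSeries in
/-- With `B(X) = X / (e^X - 1)`, the series `B(2X) - B(X)` equals `-X / (e^X + 1)`. -/
theorem rescale_two_bernoulliPowerSeries_sub_mul_exp_add_one :
    (rescale (2 : ℚ) (bernoulliPowerSeries ℚ) - bernoulliPowerSeries ℚ) * (exp ℚ + 1) =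
      -(X : ℚ⟦X⟧) := by
  have hB := bernoulliPowerSeries_mul_exp_sub_one ℚ
  have hE : rescale (2 : ℚ) (exp ℚ) = exp ℚ ^ 2 := by
    simpa using (exp_pow_eq_rescale_exp (A := ℚ) 2).symm
  have hR : rescale (2 : ℚ) (bernoulliPowerSeries ℚ) * (exp ℚ ^ 2 - 1) = 2 * X := by
    have h := congrArg (rescale (2 : ℚ)) hB
    rw [map_mul, map_sub, map_one, hE, rescale_X] at h
    rw [h, map_ofNat]
  have hne : exp ℚ - 1 ≠ 0 := fun h => X_ne_zero (by rw [← hB, h, mul_zero])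
  apply mul_right_cancel₀ hne
  linear_combination hR - (exp ℚ + 1) * hB

/-- The binomial transform of `(2 ^ j - 1) * B_j` is its negative, from index `2` on. -/
theorem sum_choose_mul_two_pow_sub_one_mul_bernoulli (m : ℕ) (hm : 2 ≤ m) :
    ∑ j ∈ Finset.range (m + 1), (m.choose j : ℚ) * ((2 ^ j - 1) * bernoulli j) =
      -((2 ^ m - 1) * bernoulli m) := by
  have h := congrArg (PowerSeries.coeff m) rescale_two_bernoulliPowerSeries_sub_mul_exp_add_one
  rw [mul_add, mul_one, map_add, PowerSeries.coeff_mul,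
    Finset.Nat.sum_antidiagonal_eq_sum_range_succ_mk, map_neg, PowerSeries.coeff_X,
    if_neg (by omega), neg_zero] at h
  simp only [map_sub, PowerSeries.coeff_rescale, bernoulliPowerSeries, PowerSeries.coeff_mk,
    PowerSeries.coeff_exp, Algebra.algebraMap_self, RingHom.id_apply] at h
  have hfac (k : ℕ) : (k.factorial : ℚ) ≠ 0 := by exact_mod_cast k.factorial_ne_zero
  have h' := congrArg (fun x => (m.factorial : ℚ) * x) h
  simp only [mul_add, Finset.mul_sum, mul_zero] at h'
  rw [eq_neg_iff_add_eq_zero, ← h']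
  congr 1
  · refine Finset.sum_congr rfl fun j hj => ?_
    rw [Nat.cast_choose ℚ (Nat.lt_succ_iff.mp (Finset.mem_range.mp hj))]
    have := hfac j
    have := hfac (m - j)
    field_simp
  · have := hfac m
    field_simp

/-- For every `n ≥ 1`,
`Σ_{i=0}^{n} binom(n,i) · ((2^{i+2}−2)/(i+1)) · B_{i+1} = −((2^{n+2}−2)/(n+1)) · B_{n+1}`,
where `B_k` are the Bernoulli numbers (with `B_1 = −1/2`, generating function
`u/(e^u − 1)`). -/
theorem bernoulli_identity (n : ℕ) (hn : 1 ≤ n) :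
    ∑ i ∈ Finset.range (n + 1),
        (n.choose i : ℚ) * (((2 : ℚ) ^ (i + 2) - 2) / ((i : ℚ) + 1)) * bernoulli (i + 1) =
      -((((2 : ℚ) ^ (n + 2) - 2) / ((n : ℚ) + 1)) * bernoulli (n + 1)) := by
  have hn1 : (n : ℚ) + 1 ≠ 0 := by positivity
  have h := sum_choose_mul_two_pow_sub_one_mul_bernoulli (n + 1) (by omega)
  rw [Finset.sum_range_succ'] at h
  simp only [pow_zero, sub_self, zero_mul, mul_zero, add_zero] at h
  have hterm (i : ℕ) :
      (n.choose i : ℚ) * (((2 : ℚ) ^ (i + 2) - 2) / ((i : ℚ) + 1)) * bernoulli (i + 1) =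
        2 / ((n : ℚ) + 1) *
          (((n + 1).choose (i + 1) : ℚ) * ((2 ^ (i + 1) - 1) * bernoulli (i + 1))) := by
    have hi1 : (i : ℚ) + 1 ≠ 0 := by positivity
    have hc : ((n : ℚ) + 1) * n.choose i = (n + 1).choose (i + 1) * ((i : ℚ) + 1) := by
      exact_mod_cast Nat.add_one_mul_choose_eq n i
    field_simp
    linear_combination (2 ^ (i + 2) - 2) * bernoulli (i + 1) * hc
  rw [Finset.sum_congr rfl fun i _ => hterm i, ← Finset.mul_sum, h]
  field_simp
  ring
end

section
/- Let A, B ∈ ℚ⟦z⟧ be the formal power series A(z) = Σ_{i≥0} ((6i)!/((3i)!(2i)!)) · (z/72)^i and B(z) = Σ_{i≥0} ((6i)!/((3i)!(2i)!)) · ((6i+1)/(6i−1)) · (z/72)^i, and set C := B·A^{−1} (A has constant term 1, hence is invertible). Then C satisfies the differential equation 12·z²·(dC/dz) = 1 + 4·z·C − C² in ℚ⟦z⟧. -/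
open scoped BigOperators
open PowerSeries

/-- `A(z) = Σ_{i≥0} ((6i)!/((3i)!(2i)!)) · (z/72)^i ∈ ℚ⟦z⟧`. -/
noncomputable def Aser : PowerSeries ℚ :=
  PowerSeries.mk fun i =>
    (((6 * i).factorial : ℚ) / (((3 * i).factorial : ℚ) * ((2 * i).factorial : ℚ))) *
      (1 / 72 : ℚ) ^ i

/-- `B(z) = Σ_{i≥0} ((6i)!/((3i)!(2i)!)) · ((6i+1)/(6i−1)) · (z/72)^i ∈ ℚ⟦z⟧`. -/
noncomputable def Bser : PowerSeries ℚ :=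
  PowerSeries.mk fun i =>
    (((6 * i).factorial : ℚ) / (((3 * i).factorial : ℚ) * ((2 * i).factorial : ℚ))) *
      ((6 * (i : ℚ) + 1) / (6 * (i : ℚ) - 1)) * (1 / 72 : ℚ) ^ i

/-- `C := B·A⁻¹`. -/
noncomputable def Cser : PowerSeries ℚ := Bser * Aser⁻¹

/-- The hypergeometric recurrence for the coefficients of `A`. -/
theorem coeff_succ_Aser (n : ℕ) :
    6 * ((n : ℚ) + 1) * coeff (n + 1) Aser =
      (6 * (n : ℚ) + 5) * (6 * n + 1) * coeff n Aser := by
  simp only [Aser, coeff_mk]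
  rw [show 6 * (n + 1) = 6 * n + 5 + 1 by ring, show 3 * (n + 1) = 3 * n + 2 + 1 by ring,
    show 2 * (n + 1) = 2 * n + 1 + 1 by ring]
  simp only [Nat.factorial_succ, pow_succ]
  have h6 : ((6 * n).factorial : ℚ) ≠ 0 := by positivity
  have h3 : ((3 * n).factorial : ℚ) ≠ 0 := by positivity
  have h2 : ((2 * n).factorial : ℚ) ≠ 0 := by positivity
  push_cast
  field_simp
  ring

theorem coeff_Bser (n : ℕ) :
    (6 * (n : ℚ) - 1) * coeff n Bser = (6 * n + 1) * coeff n Aser := by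
  have h : 6 * (n : ℚ) - 1 ≠ 0 := by
    intro h
    have : 6 * (n : ℤ) - 1 = 0 := by exact_mod_cast h
    omega
  simp only [Aser, Bser, coeff_mk]
  field_simp

theorem X_mul_derivative_Bser :
    6 * (X * derivative ℚ Bser) - Bser = 6 * (X * derivative ℚ Aser) + Aser := by
  ext n
  have h := coeff_Bser n
  rw [show (6 : PowerSeries ℚ) = C 6 from rfl]
  cases n with
  | zero => simpa using h
  | succ n =>
    simp only [map_sub, map_add, coeff_C_mul, coeff_succ_X_mul, coeff_derivative]
    push_cast at h
    linear_combination h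

theorem X_sq_mul_derivative_Aser :
    12 * (X * (X * derivative ℚ Aser)) = Aser + Bser - 2 * (X * Aser) := by
  ext n
  rw [show (12 : PowerSeries ℚ) = C 12 from rfl, show (2 : PowerSeries ℚ) = C 2 from rfl]
  cases n with
  | zero => simp [Aser, Bser]
  | succ n =>
    have hB := coeff_Bser (n + 1)
    have hA := coeff_succ_Aser n
    have h5 : 6 * (n : ℚ) + 5 ≠ 0 := by positivity
    have hX : coeff n (X * derivative ℚ Aser) = n * coeff n Aser := by
      cases n with
      | zero => simp
      | succ n =>
        simp only [coeff_succ_X_mul, coeff_derivative]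
        push_cast
        ring
    simp only [map_sub, map_add, coeff_C_mul, coeff_succ_X_mul, hX]
    push_cast at hB
    apply mul_left_cancel₀ h5
    linear_combination -hB - 2 * hA

/-- `C = B/A` satisfies the differential equation `12·z²·C′ = 1 + 4·z·C − C²` in `ℚ⟦z⟧`. -/
theorem Cser_differential_equation :
    12 * PowerSeries.X ^ 2 * PowerSeries.derivative ℚ Cser =
      1 + 4 * PowerSeries.X * Cser - Cser ^ 2 := by
  have hA0 : constantCoeff Aser ≠ 0 := by simp [Aser]
  have hA : Aser ≠ 0 := fun h => hA0 (by simp [h])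
  have hC : Cser * Aser = Bser := by
    rw [Cser, mul_assoc, PowerSeries.inv_mul_cancel _ hA0, mul_one]
  have hD : Cser * derivative ℚ Aser + Aser * derivative ℚ Cser = derivative ℚ Bser := by
    rw [← hC, Derivation.leibniz, smul_eq_mul, smul_eq_mul]
  have h1 := X_mul_derivative_Bser
  have h2 := X_sq_mul_derivative_Aser
  rw [← hD, ← hC] at h1
  rw [← hC] at h2
  apply mul_left_cancel₀ hA
  linear_combination 2 * X * h1 + (1 - Cser) * h2
end

section
/- With the polynomials f_{i,j} ∈ ℚ[z] defined by f_{1,1} = 1, f_{1,j} = 0 for j ≠ 1, f_{i,j} = 0 for j < 0, and f_{i+1,j} = (j+1)·f_{i,j+1} + 4·(j−i)·z·f_{i,j} − (j−1)·f_{i,j−1}, the following holds for every j ≥ 1, as an identity of formal power series in x with coefficients in ℚ[z]: (−1)^{j−1}·j·Σ_{i≥1} f_{i,j}·x^i/i! = (Σ_{i≥1} f_{i,1}·x^i/i!)^j. Equivalently, the two-variable series F = 1 + Σ_{i,j≥1} ((−1)^{j−1} f_{i,j}/(i!·(j−1)!))·x^i·y^j can be written F = exp(y·G) for a power series G ∈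 ℚ[z]⟦x⟧. -/
open scoped BigOperators
open PowerSeries

/-- The polynomials `f_{i,j} ∈ ℚ[z]`: `f_{1,1} = 1`, `f_{1,j} = 0` for `j ≠ 1`,
`f_{i,j} = 0` for `j < 0`, and
`f_{i+1,j} = (j+1)·f_{i,j+1} + 4·(j−i)·z·f_{i,j} − (j−1)·f_{i,j−1}`. -/
noncomputable def fpoly : ℕ → ℤ → Polynomial ℚ
  | 0, _ => 0
  | 1, j => if j = 1 then 1 else 0
  | (n + 2), j =>
      Polynomial.C ((j : ℚ) + 1) * fpoly (n + 1) (j + 1) +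
        Polynomial.C (4 * ((j : ℚ) - ((n + 1 : ℕ) : ℚ))) * Polynomial.X * fpoly (n + 1) j -
        Polynomial.C ((j : ℚ) - 1) * fpoly (n + 1) (j - 1)

/-- The exponential generating series `Σ_{i≥1} f_{i,j}·x^i/i! ∈ ℚ[z]⟦x⟧` of the column
`j` of the array `f_{i,j}`. -/
noncomputable def fcolumn (j : ℤ) : PowerSeries (Polynomial ℚ) :=
  PowerSeries.mk fun i =>
    if i = 0 then 0 else ((i.factorial : ℚ)⁻¹) • fpoly i j

theorem derivative_C_mul {R : Type*} [CommRing R] (a : R) (f : PowerSeries R) :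
    d⁄dX R (C a * f) = C a * d⁄dX R f := by
  ext n
  simp [coeff_derivative]

theorem coeff_zero_fcolumn (j : ℤ) : coeff 0 (fcolumn j) = 0 := by
  simp [fcolumn]

/-- The recurrence of `fpoly`, as a recurrence for the coefficients of `fcolumn`. -/
theorem coeff_succ_fcolumn (j : ℤ) (n : ℕ) :
    coeff (n + 1) (fcolumn j) * ((n : Polynomial ℚ) + 1) =
      (if n = 0 ∧ j = 1 then 1 else 0) +
        ((j : Polynomial ℚ) + 1) * coeff n (fcolumn (j + 1)) +
        4 * ((j : Polynomial ℚ) - (n : Polynomial ℚ)) * Polynomial.X * coeff n (fcolumn j) -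
        ((j : Polynomial ℚ) - 1) * coeff n (fcolumn (j - 1)) := by
  rcases n with _ | n
  · simp [fcolumn, fpoly]
  · have hfac : Polynomial.C (((n + 1 + 1).factorial : ℚ)⁻¹) * ((n : Polynomial ℚ) + 1 + 1) =
        Polynomial.C (((n + 1).factorial : ℚ)⁻¹) := by
      have h : ((n : Polynomial ℚ) + 1 + 1) = Polynomial.C ((n : ℚ) + 1 + 1) := by simp
      rw [h, ← Polynomial.C_mul, Nat.factorial_succ (n + 1)]
      congr 1
      push_cast
      field_simp
    simp only [fcolumn, coeff_mk, Nat.add_eq_zero_iff, one_ne_zero, and_false, false_and,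
      if_false, Polynomial.smul_eq_C_mul, fpoly]
    push_cast
    rw [mul_right_comm, hfac]
    simp only [map_add, map_sub, map_mul, map_one, map_intCast, map_natCast, map_ofNat]
    ring

/-- The differential recurrence between neighbouring columns. -/
theorem one_add_mul_derivative_fcolumn (j : ℤ) :
    (1 + C (4 * Polynomial.X) * X) * d⁄dX (Polynomial ℚ) (fcolumn j) =
      (if j = 1 then 1 else 0) + C ((j : Polynomial ℚ) + 1) * fcolumn (j + 1) +
        C (4 * (j : Polynomial ℚ) * Polynomial.X) * fcolumn j -
        C ((j : Polynomial ℚ) - 1) * fcolumn (j - 1) := by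
  ext1 n
  have hδ : coeff n (if j = 1 then 1 else 0 : PowerSeries (Polynomial ℚ)) =
      if n = 0 ∧ j = 1 then 1 else 0 := by
    by_cases hj : j = 1 <;> simp [hj, coeff_one]
  have hX : coeff n (X * d⁄dX (Polynomial ℚ) (fcolumn j)) = n * coeff n (fcolumn j) := by
    rcases n with _ | n
    · simp
    · rw [coeff_succ_X_mul, coeff_derivative]
      push_cast
      ring
  rw [add_mul, one_mul, mul_assoc]
  simp only [map_add (coeff n), map_sub (coeff n), coeff_C_mul, hδ, hX, coeff_derivative]
  rw [coeff_succ_fcolumn]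
  ring

/-- `fcolumn j` normalised so that it becomes a power of `fcolumn 1`, with value `1` at `0`. -/
noncomputable def signedColumn (j : ℕ) : PowerSeries (Polynomial ℚ) :=
  if j = 0 then 1 else (-1) ^ (j - 1) * (j : PowerSeries (Polynomial ℚ)) * fcolumn j

theorem signedColumn_zero : signedColumn 0 = 1 := if_pos rfl

theorem signedColumn_succ (j : ℕ) :
    signedColumn (j + 1) = (-1) ^ j * ((j : PowerSeries (Polynomial ℚ)) + 1) *
      fcolumn ((j : ℤ) + 1) := by
  simp [signedColumn]

theorem signedColumn_one : signedColumn 1 = fcolumn 1 := by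
  simp [signedColumn]

theorem one_add_mul_derivative_signedColumn (j : ℕ) :
    (1 + C (4 * Polynomial.X) * X) * d⁄dX (Polynomial ℚ) (signedColumn (j + 1)) =
      ((j : PowerSeries (Polynomial ℚ)) + 1) *
        (signedColumn j + C (4 * Polynomial.X) * signedColumn (j + 1) -
          signedColumn (j + 2)) := by
  have hd : d⁄dX (Polynomial ℚ) (signedColumn (j + 1)) =
      (-1) ^ j * ((j : PowerSeries (Polynomial ℚ)) + 1) *
        d⁄dX (Polynomial ℚ) (fcolumn ((j : ℤ) + 1)) := by
    have h : (-1) ^ j * ((j : PowerSeries (Polynomial ℚ)) + 1) =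
        C ((-1) ^ j * ((j : Polynomial ℚ) + 1)) := by simp
    rw [signedColumn_succ, h, derivative_C_mul]
  have h := one_add_mul_derivative_fcolumn ((j : ℤ) + 1)
  rw [hd, mul_left_comm, h, signedColumn_succ, signedColumn_succ]
  rcases j with _ | j
  · simp [signedColumn_zero]
    ring
  · rw [signedColumn_succ, if_neg (by omega)]
    simp only [map_add, map_sub, map_mul, map_one, map_ofNat]
    push_cast
    simp only [map_add, map_natCast, map_one, add_assoc]
    ring_nf

theorem coeff_signedColumn_sub_pow (n j : ℕ) :
    coeff n (signedColumn j - fcolumn 1 ^ j) = 0 := by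
  induction n using Nat.strong_induction_on generalizing j with
  | _ n ih =>
    rcases j with _ | j
    · simp [signedColumn_zero]
    rcases n with _ | n
    · have h := coeff_zero_fcolumn 1
      have h' := coeff_zero_fcolumn ((j : ℤ) + 1)
      rw [coeff_zero_eq_constantCoeff_apply] at h h' ⊢
      simp [signedColumn_succ, h, h']
    have hode : (1 + C (4 * Polynomial.X) * X) *
          d⁄dX (Polynomial ℚ) (signedColumn (j + 1) - fcolumn 1 ^ (j + 1)) =
        C ((j : Polynomial ℚ) + 1) * ((signedColumn j - fcolumn 1 ^ j) +
          C (4 * Polynomial.X) * (signedColumn (j + 1) - fcolumn 1 ^ (j + 1)) -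
          (signedColumn (j + 2) - fcolumn 1 ^ (j + 2)) +
          fcolumn 1 ^ j * (signedColumn 2 - fcolumn 1 ^ 2)) := by
      have h₁ := one_add_mul_derivative_signedColumn 0
      have hj := one_add_mul_derivative_signedColumn j
      simp only [zero_add, signedColumn_zero, signedColumn_one, Nat.cast_zero, one_mul] at h₁
      rw [map_sub, derivative_pow, Nat.add_sub_cancel, mul_sub, hj]
      simp only [map_add, map_natCast, map_one, Nat.cast_add, Nat.cast_one]
      linear_combination (-((j : PowerSeries (Polynomial ℚ)) + 1) * fcolumn 1 ^ j) * h₁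
    have hprod : coeff n (fcolumn 1 ^ j * (signedColumn 2 - fcolumn 1 ^ 2)) = 0 := by
      rw [coeff_mul]
      refine Finset.sum_eq_zero fun p hp => ?_
      rw [ih p.2 (Finset.Nat.antidiagonal.snd_lt hp), mul_zero]
    have hX : coeff n (X * d⁄dX (Polynomial ℚ) (signedColumn (j + 1) - fcolumn 1 ^ (j + 1))) =
        0 := by
      rcases n with _ | n
      · simp
      · rw [coeff_succ_X_mul, coeff_derivative, ih _ (Nat.lt_succ_self _), zero_mul]
    have hcoeff := congrArg (coeff n) hode
    have ihn := ih n (Nat.lt_succ_self n)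
    rw [add_mul, one_mul, mul_assoc, map_add (coeff n), coeff_C_mul, hX, coeff_C_mul,
      map_add (coeff n), hprod, map_sub (coeff n), ihn, map_add (coeff n), coeff_C_mul, ihn, ihn,
      coeff_derivative] at hcoeff
    have hn : (n : Polynomial ℚ) + 1 ≠ 0 := by exact_mod_cast Nat.succ_ne_zero n
    simpa [hn] using hcoeff

theorem signedColumn_eq_pow (j : ℕ) : signedColumn j = fcolumn 1 ^ j :=
  sub_eq_zero.mp (PowerSeries.ext fun n => by
    rw [coeff_signedColumn_sub_pow, map_zero])

/-- For every `j ≥ 1`, as formal power series in `x` with coefficients in `ℚ[z]`: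
`(−1)^{j−1}·j·Σ_{i≥1} f_{i,j}·x^i/i! = (Σ_{i≥1} f_{i,1}·x^i/i!)^j`.
Equivalently, the two-variable series
`F = 1 + Σ_{i,j≥1} ((−1)^{j−1} f_{i,j}/(i!·(j−1)!))·x^i·y^j` is the exponential
`exp(y·G)` of a series `G ∈ ℚ[z]⟦x⟧`. -/
theorem fcolumn_power_identity (j : ℕ) (hj : 1 ≤ j) :
    ((-1 : PowerSeries (Polynomial ℚ)) ^ (j - 1)) * (j : PowerSeries (Polynomial ℚ)) *
        fcolumn (j : ℤ) =
      (fcolumn 1) ^ j := by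
  rw [← signedColumn_eq_pow, signedColumn, if_neg (by omega)]
end

section
/- Let f_{i,j,k} ∈ ℚ denote the coefficient of z^k in the polynomial f_{i,j} ∈ ℚ[z]. Then for all integers i ≥ 1, j ≥ 1, k ≥ 0: ((−1)^{j−1}/(j−1)!)·f_{i,j,k} = Σ_{P} Σ_{m} ∏_{S∈P} f_{|S|,1,m(S)}, where the outer sum runs over all set partitions P of {1,…,i} with exactly j blocks and the inner sum over all functions m assigning a nonnegative integer to each block of P with Σ_{S∈P} m(S) = k. -/
open scoped BigOperators
/-- `f_{i,j,k} ∈ ℚ` is the coefficient of `z^k` in `f_{i,j}`. -/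
noncomputable def fcoef (i : ℕ) (j : ℤ) (k : ℕ) : ℚ := (fpoly i j).coeff k

open Polynomial in
/-- Ordinary coefficients of the power series solution `G` of
`(1 + 4zx) G' = 1 + 4z G - G²`, `G(0) = 0`. -/
noncomputable def riccatiCoeff : ℕ → ℚ[X]
  | 0 => 0
  | n + 1 => C (1 / ((n : ℚ) + 1)) * ((if n = 0 then 1 else 0)
      + 4 * X * (1 - (n : ℚ[X])) * riccatiCoeff n
      - ∑ k : Fin (n + 1), riccatiCoeff k * riccatiCoeff (n - k))

/-- The power series solution of `(1 + 4zx) G' = 1 + 4z G - G²`, `G(0) = 0`. -/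
noncomputable def riccatiSeries : PowerSeries (Polynomial ℚ) := PowerSeries.mk riccatiCoeff

theorem constantCoeff_riccatiSeries : PowerSeries.constantCoeff riccatiSeries = 0 := by
  rw [← PowerSeries.coeff_zero_eq_constantCoeff_apply, riccatiSeries, PowerSeries.coeff_mk,
    riccatiCoeff]

theorem coeff_X_mul_derivative {R : Type*} [CommRing R] (F : PowerSeries R) (n : ℕ) :
    PowerSeries.coeff n (PowerSeries.X * PowerSeries.derivative R F) =
      n * PowerSeries.coeff n F := by
  cases n with
  | zero => simp
  | succ n => simp [PowerSeries.coeff_succ_X_mul, PowerSeries.coeff_derivative, mul_comm]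

theorem derivative_pow_succ {R : Type*} [CommRing R] (G : PowerSeries R) (j : ℕ) :
    PowerSeries.derivative R (G ^ (j + 1)) =
      PowerSeries.C ((j : R) + 1) * (G ^ j * PowerSeries.derivative R G) := by
  rw [Derivation.leibniz_pow]
  simp

theorem riccatiSeries_derivative :
    PowerSeries.derivative _ riccatiSeries
        + PowerSeries.C (4 * Polynomial.X)
          * (PowerSeries.X * PowerSeries.derivative _ riccatiSeries) =
      1 + PowerSeries.C (4 * Polynomial.X) * riccatiSeries - riccatiSeries ^ 2 := by
  ext1 n
  have hsq : PowerSeries.coeff n (riccatiSeries ^ 2) =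
      ∑ k : Fin (n + 1), riccatiCoeff k * riccatiCoeff (n - k) := by
    rw [sq, PowerSeries.coeff_mul, Finset.Nat.sum_antidiagonal_eq_sum_range_succ_mk,
      Finset.sum_range]
    simp [riccatiSeries]
  have hC : Polynomial.C (1 / ((n : ℚ) + 1)) * ((n : Polynomial ℚ) + 1) = 1 := by
    have h : ((n : Polynomial ℚ) + 1) = Polynomial.C ((n : ℚ) + 1) := by simp
    rw [h, ← Polynomial.C_mul, one_div_mul_cancel (by positivity), Polynomial.C_1]
  rw [map_sub, map_add, map_add, hsq, PowerSeries.coeff_C_mul, PowerSeries.coeff_C_mul,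
    coeff_X_mul_derivative, PowerSeries.coeff_derivative, PowerSeries.coeff_one]
  simp only [riccatiSeries, PowerSeries.coeff_mk]
  rw [riccatiCoeff]
  linear_combination ((if n = 0 then 1 else 0)
      + 4 * Polynomial.X * (1 - (n : Polynomial ℚ)) * riccatiCoeff n
      - ∑ k : Fin (n + 1), riccatiCoeff k * riccatiCoeff (n - k)) * hC

theorem coeff_riccatiSeries_pow_succ (n j : ℕ) :
    ((n : Polynomial ℚ) + 1) * PowerSeries.coeff (n + 1) (riccatiSeries ^ (j + 1)) =
      ((j : Polynomial ℚ) + 1) * (PowerSeries.coeff n (riccatiSeries ^ j)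
        - PowerSeries.coeff n (riccatiSeries ^ (j + 2)))
      + 4 * Polynomial.X * ((j : Polynomial ℚ) + 1 - (n : Polynomial ℚ)) * PowerSeries.coeff n (riccatiSeries ^ (j + 1)) := by
  have key : PowerSeries.derivative _ (riccatiSeries ^ (j + 1))
        + PowerSeries.C (4 * Polynomial.X)
          * (PowerSeries.X * PowerSeries.derivative _ (riccatiSeries ^ (j + 1))) =
      PowerSeries.C ((j : Polynomial ℚ) + 1) * (riccatiSeries ^ j - riccatiSeries ^ (j + 2))
        + PowerSeries.C ((j : Polynomial ℚ) + 1) * (PowerSeries.C (4 * Polynomial.X)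
          * riccatiSeries ^ (j + 1)) := by
    rw [derivative_pow_succ]
    linear_combination PowerSeries.C ((j : Polynomial ℚ) + 1) * riccatiSeries ^ j
      * riccatiSeries_derivative
  have := congrArg (PowerSeries.coeff n) key
  simp only [map_add, PowerSeries.coeff_C_mul, coeff_X_mul_derivative,
    PowerSeries.coeff_derivative] at this
  simp only [← map_add, PowerSeries.coeff_C_mul, map_sub] at this
  linear_combination this

theorem fpoly_succ_eq_coeff_riccatiSeries_pow (n j : ℕ) :
    fpoly (n + 1) ((j : ℤ) + 1) = Polynomial.C ((-1) ^ j / ((j : ℚ) + 1)) *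
      ((n + 1).factorial * PowerSeries.coeff (n + 1) (riccatiSeries ^ (j + 1))) := by
  induction n generalizing j with
  | zero =>
    have h := coeff_riccatiSeries_pow_succ 0 j
    rcases j with _ | j
    · simp [fpoly, constantCoeff_riccatiSeries] at h ⊢
      exact h.symm
    · simp [fpoly, constantCoeff_riccatiSeries] at h ⊢
      rw [if_neg (by omega), h, mul_zero]
  | succ n ih =>
    have h := coeff_riccatiSeries_pow_succ (n + 1) j
    have e1 := ih (j + 1)
    have e0 := ih j
    rw [fpoly, Nat.factorial_succ (n + 1)]
    push_cast at h e1 e0 ⊢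
    have hC : ((j : Polynomial ℚ) + 1) = Polynomial.C ((j : ℚ) + 1) := by simp
    rw [e1, e0]
    have hprev : Polynomial.C ((j : ℚ) + 1 - 1) * fpoly (n + 1) ((j : ℤ) + 1 - 1) =
        - Polynomial.C ((-1) ^ j) * (((n + 1).factorial : Polynomial ℚ)
          * PowerSeries.coeff (n + 1) (riccatiSeries ^ j)) := by
      rcases j with _ | j
      · simp [PowerSeries.coeff_one]
      · push_cast
        rw [add_sub_cancel_right, add_sub_cancel_right, ih j, ← mul_assoc, ← Polynomial.C_mul,
          ← Polynomial.C_neg]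
        congr 2
        field_simp
        ring
    rw [hprev]
    have hj : ((j : ℚ) + 1) ≠ 0 := by positivity
    have hj2 : ((j : ℚ) + 1 + 1) ≠ 0 := by positivity
    have hA : Polynomial.C ((j : ℚ) + 1 + 1) * Polynomial.C ((-1) ^ (j + 1) / ((j : ℚ) + 1 + 1))
        = - Polynomial.C ((-1 : ℚ) ^ j) := by
      rw [← Polynomial.C_mul, ← Polynomial.C_neg]
      congr 1
      field_simp
      ring
    have hB : Polynomial.C ((-1) ^ j / ((j : ℚ) + 1)) * ((j : Polynomial ℚ) + 1) =
        Polynomial.C ((-1 : ℚ) ^ j) := by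
      rw [hC, ← Polynomial.C_mul]
      congr 1
      field_simp
    have hD : Polynomial.C (4 * ((j : ℚ) + 1 - ((n : ℚ) + 1))) =
        4 * ((j : Polynomial ℚ) + 1 - (n + 1)) := by
      rw [Polynomial.C_mul, map_ofNat]
      simp
    rw [hD]
    linear_combination
      ((n + 1).factorial * PowerSeries.coeff (n + 1) (riccatiSeries ^ (j + 2))) * hA
      - Polynomial.C ((-1) ^ j / ((j : ℚ) + 1)) * (n + 1).factorial * h
      - (n + 1).factorial * (PowerSeries.coeff (n + 1) (riccatiSeries ^ j)
        - PowerSeries.coeff (n + 1) (riccatiSeries ^ (j + 2))) * hB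

/-- The set partitions of `s` with exactly `j` blocks. -/
def setPartitions {α : Type*} [DecidableEq α] (s : Finset α) (j : ℕ) :
    Finset (Finset (Finset α)) :=
  s.powerset.powerset.filter (fun P => (∀ S ∈ P, S.Nonempty) ∧
    (∀ S ∈ P, ∀ T ∈ P, S ≠ T → S ∩ T = ∅) ∧ P.biUnion id = s ∧ P.card = j)

theorem mem_setPartitions {α : Type*} [DecidableEq α] {s : Finset α} {j : ℕ}
    {P : Finset (Finset α)} :
    P ∈ setPartitions s j ↔ (∀ S ∈ P, S.Nonempty) ∧
      (∀ S ∈ P, ∀ T ∈ P, S ≠ T → S ∩ T = ∅) ∧ P.biUnion id = s ∧ P.card = j := by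
  rw [setPartitions, Finset.mem_filter, and_iff_right_iff_imp]
  rintro ⟨-, -, rfl, -⟩
  rw [Finset.mem_powerset]
  exact fun S hS => Finset.mem_powerset.2 (Finset.subset_biUnion_of_mem id hS)

theorem subset_of_mem_setPartitions {α : Type*} [DecidableEq α] {s : Finset α} {j : ℕ}
    {P : Finset (Finset α)} (hP : P ∈ setPartitions s j) {S : Finset α} (hS : S ∈ P) : S ⊆ s := by
  rw [mem_setPartitions] at hP
  rw [← hP.2.2.1]
  exact Finset.subset_biUnion_of_mem id hS

theorem insert_mem_setPartitions {α : Type*} [DecidableEq α] {B s : Finset α} {j : ℕ}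
    {P : Finset (Finset α)} (hB : B.Nonempty) (hdisj : Disjoint B s)
    (hP : P ∈ setPartitions s j) : B ∉ P ∧ insert B P ∈ setPartitions (B ∪ s) (j + 1) := by
  have hsub := fun S hS => subset_of_mem_setPartitions hP (S := S) hS
  have hBP : B ∉ P := fun h => hB.ne_empty (Finset.disjoint_self_iff_empty _ |>.1
    (hdisj.mono_right (hsub B h)))
  refine ⟨hBP, ?_⟩
  rw [mem_setPartitions] at hP ⊢
  obtain ⟨h1, h2, h3, h4⟩ := hP
  have hBS : ∀ S ∈ P, B ∩ S = ∅ := fun S hS =>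
    Finset.disjoint_iff_inter_eq_empty.1 (hdisj.mono_right (hsub S hS))
  refine ⟨?_, ?_, ?_, ?_⟩
  · simpa [hB] using h1
  · intro S hS T hT hne
    rcases Finset.mem_insert.1 hS with hSB | hSP <;>
      rcases Finset.mem_insert.1 hT with hTB | hTP
    · exact absurd (hSB.trans hTB.symm) hne
    · rw [hSB]; exact hBS T hTP
    · rw [hTB, Finset.inter_comm]; exact hBS S hSP
    · exact h2 S hSP T hTP hne
  · rw [Finset.biUnion_insert, h3, id]
  · rw [Finset.card_insert_of_notMem hBP, h4]

theorem erase_mem_setPartitions {α : Type*} [DecidableEq α] {B s : Finset α} {j : ℕ}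
    {P : Finset (Finset α)} (hP : P ∈ setPartitions s (j + 1)) (hB : B ∈ P) :
    P.erase B ∈ setPartitions (s \ B) j := by
  rw [mem_setPartitions] at hP ⊢
  obtain ⟨h1, h2, rfl, h4⟩ := hP
  refine ⟨fun S hS => h1 S (Finset.mem_of_mem_erase hS), fun S hS T hT =>
    h2 S (Finset.mem_of_mem_erase hS) T (Finset.mem_of_mem_erase hT), ?_, ?_⟩
  · ext x
    simp only [Finset.mem_biUnion, Finset.mem_erase, id, Finset.mem_sdiff]
    constructor
    · rintro ⟨S, ⟨hne, hS⟩, hx⟩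
      refine ⟨⟨S, hS, hx⟩, fun hxB => ?_⟩
      have := h2 S hS B hB hne
      exact Finset.notMem_empty x (this ▸ Finset.mem_inter.2 ⟨hx, hxB⟩)
    · rintro ⟨⟨S, hS, hx⟩, hxB⟩
      exact ⟨S, ⟨fun h => hxB (h ▸ hx), hS⟩, hx⟩
  · rw [Finset.card_erase_of_mem hB, h4, Nat.add_sub_cancel]

/-- Splitting off the block that contains the element `a`. -/
theorem sum_setPartitions_insert {α R : Type*} [DecidableEq α] [CommRing R] (w : ℕ → R)
    {a : α} {s : Finset α} (ha : a ∉ s) (j : ℕ) :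
    ∑ P ∈ setPartitions (insert a s) (j + 1), ∏ S ∈ P, w S.card =
      ∑ T ∈ s.powerset, w (T.card + 1) * ∑ P ∈ setPartitions (s \ T) j, ∏ S ∈ P, w S.card := by
  simp_rw [Finset.mul_sum]
  rw [Finset.sum_sigma']
  have hins : ∀ x ∈ s.powerset.sigma fun T => setPartitions (s \ T) j,
      insert a x.1 ∉ x.2 ∧ insert (insert a x.1) x.2 ∈ setPartitions (insert a s) (j + 1) := by
    rintro ⟨T, P⟩ hx
    obtain ⟨hT, hP⟩ := Finset.mem_sigma.1 hx
    rw [Finset.mem_powerset] at hT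
    have h := insert_mem_setPartitions (B := insert a T) (Finset.insert_nonempty a T)
      (by
        rw [Finset.disjoint_insert_left]
        exact ⟨fun h => ha (Finset.mem_sdiff.1 h).1, Finset.disjoint_sdiff⟩) hP
    rwa [Finset.insert_union, Finset.union_sdiff_of_subset hT] at h
  have hnot : ∀ x ∈ s.powerset.sigma fun T => setPartitions (s \ T) j,
      a ∉ x.1 ∧ ∀ S ∈ x.2, a ∉ S := by
    rintro ⟨T, P⟩ hx
    obtain ⟨hT, hP⟩ := Finset.mem_sigma.1 hx
    exact ⟨fun h => ha (Finset.mem_powerset.1 hT h), fun S hS h =>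
      ha (Finset.mem_sdiff.1 (subset_of_mem_setPartitions hP hS h)).1⟩
  symm
  refine Finset.sum_bij (fun x _ => insert (insert a x.1) x.2) (fun x hx => (hins x hx).2)
    ?_ ?_ ?_
  · rintro ⟨T, P⟩ hx ⟨T', P'⟩ hx' heq
    obtain ⟨h1, h2⟩ := hnot _ hx
    obtain ⟨h1', h2'⟩ := hnot _ hx'
    have hb := (hins _ hx).1
    have hb' := (hins _ hx').1
    dsimp only at heq h1 h2 h1' h2' hb hb'
    have hTT : insert a T = insert a T' := by
      have hm : insert a T ∈ insert (insert a T') P' := heq ▸ Finset.mem_insert_self _ _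
      exact (Finset.mem_insert.1 hm).resolve_right
        fun h => h2' _ h (Finset.mem_insert_self a T)
    have hT : T = T' := by
      rw [← Finset.erase_insert h1, hTT, Finset.erase_insert h1']
    subst hT
    have hP : P = P' := by
      rw [← Finset.erase_insert hb, heq, Finset.erase_insert hb']
    rw [hP]
  · intro P hP
    have hU := (mem_setPartitions.1 hP).2.2.1
    obtain ⟨B, hB, haB⟩ := Finset.mem_biUnion.1 (hU.symm ▸ Finset.mem_insert_self a s)
    rw [id] at haB
    have hBs := subset_of_mem_setPartitions hP hB
    refine ⟨⟨B.erase a, P.erase B⟩, Finset.mem_sigma.2 ⟨?_, ?_⟩, ?_⟩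
    · rw [Finset.mem_powerset]
      exact fun x hx => (Finset.mem_insert.1 (hBs (Finset.mem_of_mem_erase hx))).resolve_left
        (Finset.ne_of_mem_erase hx)
    · have h := erase_mem_setPartitions hP hB
      have hs : insert a s \ B = s \ B.erase a := by
        ext x
        by_cases hxa : x = a
        · subst hxa; simp [haB, ha]
        · simp [hxa]
      rwa [hs] at h
    · dsimp only
      rw [Finset.insert_erase haB, Finset.insert_erase hB]
  · rintro ⟨T, P⟩ hx
    dsimp only
    rw [Finset.prod_insert (hins _ hx).1, Finset.card_insert_of_notMem (hnot _ hx).1]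

theorem coeff_succ_pow_succ {R : Type*} [CommRing R] (G : PowerSeries R) (n j : ℕ) :
    ((n : R) + 1) * PowerSeries.coeff (n + 1) (G ^ (j + 1)) =
      (j + 1) * ∑ k ∈ Finset.range (n + 1), ((k : R) + 1) * PowerSeries.coeff (k + 1) G *
        PowerSeries.coeff (n - k) (G ^ j) := by
  have h := congrArg (PowerSeries.coeff n) (derivative_pow_succ G j)
  rw [mul_comm (G ^ j), PowerSeries.coeff_derivative, PowerSeries.coeff_C_mul, PowerSeries.coeff_mul,
    Finset.Nat.sum_antidiagonal_eq_sum_range_succ_mk] at h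
  simp only [PowerSeries.coeff_derivative] at h
  rw [mul_comm, h]
  simp only [mul_comm, mul_left_comm]

/-- The exponential formula with a fixed number of blocks. -/
theorem factorial_mul_sum_setPartitions {α R : Type*} [DecidableEq α] [CommRing R]
    (G : PowerSeries R) (hG : PowerSeries.constantCoeff G = 0) (s : Finset α) (j : ℕ) :
    (j.factorial : R) * ∑ P ∈ setPartitions s j,
        ∏ S ∈ P, (S.card.factorial * PowerSeries.coeff S.card G) =
      s.card.factorial * PowerSeries.coeff s.card (G ^ j) := by
  induction s using Finset.strongInduction generalizing j with
  | H s ih =>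
  rcases s.eq_empty_or_nonempty with rfl | ⟨a, ha⟩
  · rcases j with _ | j
    · have : setPartitions (∅ : Finset α) 0 = {∅} := by
        ext P
        rw [mem_setPartitions, Finset.mem_singleton]
        refine ⟨fun h => Finset.card_eq_zero.1 h.2.2.2, ?_⟩
        rintro rfl
        simp
      simp [this]
    · have : setPartitions (∅ : Finset α) (j + 1) = ∅ := by
        rw [Finset.eq_empty_iff_forall_notMem]
        intro P hP
        obtain ⟨S, hS⟩ : P.Nonempty := by
          rw [← Finset.card_pos, (mem_setPartitions.1 hP).2.2.2]; omega
        exact ((mem_setPartitions.1 hP).1 S hS).ne_empty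
          (Finset.subset_empty.1 (subset_of_mem_setPartitions hP hS))
      simp [this, hG]
  · obtain ⟨t, hat, rfl⟩ : ∃ t, a ∉ t ∧ insert a t = s :=
      ⟨s.erase a, Finset.notMem_erase a s, Finset.insert_erase ha⟩
    rw [Finset.card_insert_of_notMem hat]
    rcases j with _ | j
    · have : setPartitions (insert a t) 0 = ∅ := by
        rw [Finset.eq_empty_iff_forall_notMem]
        intro P hP
        obtain ⟨-, -, h3, h4⟩ := mem_setPartitions.1 hP
        rw [Finset.card_eq_zero.1 h4, Finset.biUnion_empty] at h3
        exact Finset.insert_ne_empty a t h3.symm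
      simp [this, PowerSeries.coeff_one]
    · rw [sum_setPartitions_insert (fun m => (m.factorial : R) * PowerSeries.coeff m G) hat]
      have hstep : (j.factorial : R) * ∑ T ∈ t.powerset,
          ((T.card + 1).factorial * PowerSeries.coeff (T.card + 1) G) *
            ∑ P ∈ setPartitions (t \ T) j,
              ∏ S ∈ P, ((S.card.factorial : R) * PowerSeries.coeff S.card G) =
          t.card.factorial * ∑ k ∈ Finset.range (t.card + 1),
            ((k : R) + 1) * PowerSeries.coeff (k + 1) G *
              PowerSeries.coeff (t.card - k) (G ^ j) := by
        have hT : ∀ T ∈ t.powerset, (j.factorial : R) *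
            (((T.card + 1).factorial * PowerSeries.coeff (T.card + 1) G) *
              ∑ P ∈ setPartitions (t \ T) j,
                ∏ S ∈ P, ((S.card.factorial : R) * PowerSeries.coeff S.card G)) =
            (fun k => ((k + 1).factorial : R) * PowerSeries.coeff (k + 1) G *
              ((t.card - k).factorial * PowerSeries.coeff (t.card - k) (G ^ j))) T.card := by
          intro T hT
          rw [mul_left_comm, ih (t \ T) (Finset.sdiff_subset.trans_ssubset
            (Finset.ssubset_insert hat)), Finset.card_sdiff_of_subset (Finset.mem_powerset.1 hT)]
        rw [Finset.mul_sum, Finset.sum_congr rfl hT, Finset.sum_powerset_apply_card (fun k => ((k + 1).factorial : R) *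
          PowerSeries.coeff (k + 1) G *
            ((t.card - k).factorial * PowerSeries.coeff (t.card - k) (G ^ j))),
          Finset.mul_sum]
        refine Finset.sum_congr rfl fun k hk => ?_
        have hk' : k ≤ t.card := Nat.lt_succ_iff.1 (Finset.mem_range.1 hk)
        rw [nsmul_eq_mul, ← Nat.choose_mul_factorial_mul_factorial hk', Nat.factorial_succ]
        push_cast
        ring
      rw [Nat.factorial_succ, Nat.factorial_succ]
      push_cast
      linear_combination ((j : R) + 1) * hstep
        - (t.card.factorial : R) * coeff_succ_pow_succ G t.card j

theorem Polynomial.coeff_prod_eq_sum_pi {ι R : Type*} [DecidableEq ι] [CommRing R]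
    (s : Finset ι) (p : ι → Polynomial R) (k : ℕ) :
    (∏ i ∈ s, p i).coeff k =
      ∑ m ∈ (s.pi fun _ => Finset.range (k + 1)).filter (fun m => ∑ i ∈ s.attach, m i.1 i.2 = k),
        ∏ i ∈ s.attach, (p i.1).coeff (m i.1 i.2) := by
  have htrunc : ∀ t : Finset ι, Polynomial.X ^ (k + 1) ∣ ∏ i ∈ t, p i
      - ∏ i ∈ t, ∑ m ∈ Finset.range (k + 1), Polynomial.monomial m ((p i).coeff m) := by
    intro t
    induction t using Finset.induction_on with
    | empty => simp
    | insert a t ha ih =>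
      rw [Finset.prod_insert ha, Finset.prod_insert ha]
      refine dvd_mul_sub_mul ?_ ih
      rw [Polynomial.X_pow_dvd_iff]
      intro d hd
      simp [Polynomial.coeff_monomial, hd]
  have h := (Polynomial.X_pow_dvd_iff.1 (htrunc s)) k (Nat.lt_succ_self k)
  rw [Polynomial.coeff_sub, sub_eq_zero] at h
  rw [h, Finset.prod_sum, Polynomial.finsetSum_coeff, Finset.sum_filter]
  refine Finset.sum_congr rfl fun m _ => ?_
  have hprod : ∀ t : Finset {x // x ∈ s},
      ∏ x ∈ t, Polynomial.monomial (m x.1 x.2) ((p x.1).coeff (m x.1 x.2)) =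
        Polynomial.monomial (∑ x ∈ t, m x.1 x.2) (∏ x ∈ t, (p x.1).coeff (m x.1 x.2)) := by
    intro t
    induction t using Finset.induction_on with
    | empty => simp
    | insert a t ha ih =>
      rw [Finset.prod_insert ha, Finset.prod_insert ha, Finset.sum_insert ha, ih,
        Polynomial.monomial_mul_monomial]
  rw [hprod, Polynomial.coeff_monomial]

/-- For all `i ≥ 1`, `j ≥ 1`, `k ≥ 0`:
`((−1)^{j−1}/(j−1)!)·f_{i,j,k} = Σ_P Σ_m ∏_{S∈P} f_{|S|,1,m(S)}`, where `P` runs over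
set partitions of `{1,…,i}` with exactly `j` blocks (encoded as finsets of nonempty,
pairwise disjoint blocks covering `Fin i`) and `m` over assignments of nonnegative
integers to the blocks of `P` with total sum `k`. -/
theorem fcoef_set_partition_identity (i j k : ℕ) (hi : 1 ≤ i) (hj : 1 ≤ j) :
    ((-1 : ℚ) ^ (j - 1) / ((j - 1).factorial : ℚ)) * fcoef i (j : ℤ) k =
      ∑ P ∈ (Finset.univ : Finset (Finset (Finset (Fin i)))).filter
          (fun P => (∀ S ∈ P, S.Nonempty) ∧
            (∀ S ∈ P, ∀ T ∈ P, S ≠ T → S ∩ T = ∅) ∧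
            P.biUnion id = Finset.univ ∧ P.card = j),
        ∑ m ∈ (P.pi fun _ => Finset.range (k + 1)).filter
            (fun m => (∑ S ∈ P.attach, m S.1 S.2) = k),
          ∏ S ∈ P.attach, fcoef S.1.card 1 (m S.1 S.2) := by
  obtain ⟨n, rfl⟩ := Nat.exists_eq_add_of_le' hi
  obtain ⟨l, rfl⟩ := Nat.exists_eq_add_of_le' hj
  have hfilter : (Finset.univ : Finset (Finset (Finset (Fin (n + 1))))).filter
      (fun P => (∀ S ∈ P, S.Nonempty) ∧ (∀ S ∈ P, ∀ T ∈ P, S ≠ T → S ∩ T = ∅) ∧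
        P.biUnion id = Finset.univ ∧ P.card = l + 1) =
      setPartitions Finset.univ (l + 1) := by
    ext P
    rw [mem_setPartitions, Finset.mem_filter, and_iff_right (Finset.mem_univ P)]
  have hinner : ∀ P ∈ setPartitions (Finset.univ : Finset (Fin (n + 1))) (l + 1),
      ∑ m ∈ (P.pi fun _ => Finset.range (k + 1)).filter
          (fun m => (∑ S ∈ P.attach, m S.1 S.2) = k),
        ∏ S ∈ P.attach, fcoef S.1.card 1 (m S.1 S.2) =
      (∏ S ∈ P, (S.card.factorial * PowerSeries.coeff S.card riccatiSeries)).coeff k := by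
    intro P hP
    simp only [fcoef]
    rw [← Polynomial.coeff_prod_eq_sum_pi P (fun S => fpoly S.card 1)]
    congr 1
    refine Finset.prod_congr rfl fun S hS => ?_
    obtain ⟨c, hc⟩ := Nat.exists_eq_add_of_le' ((mem_setPartitions.1 hP).1 S hS).card_pos
    have h := fpoly_succ_eq_coeff_riccatiSeries_pow c 0
    simpa [hc] using h
  rw [hfilter, Finset.sum_congr rfl hinner, ← Polynomial.finsetSum_coeff]
  have hexp := factorial_mul_sum_setPartitions riccatiSeries constantCoeff_riccatiSeries
    (Finset.univ : Finset (Fin (n + 1))) (l + 1)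
  rw [Finset.card_univ, Fintype.card_fin] at hexp
  rw [fcoef, Nat.cast_succ, fpoly_succ_eq_coeff_riccatiSeries_pow, ← hexp,
    Polynomial.coeff_C_mul, ← Polynomial.C_eq_natCast, Polynomial.coeff_C_mul, ← mul_assoc,
    ← mul_assoc, Nat.add_sub_cancel, Nat.factorial_succ]
  have hsq : ((-1 : ℚ) ^ l) * (-1) ^ l = 1 := by rw [← mul_pow]; simp
  have hl : (l.factorial : ℚ) ≠ 0 := by positivity
  have hl1 : (l : ℚ) + 1 ≠ 0 := by positivity
  convert one_mul _ using 2
  push_cast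
  field_simp
  rw [sq, hsq]
end
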